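/- Let a, b, c > 0 be real numbers and let t be a real number with t < b·c. Then the moment generating function of the Beta Exponential distribution satisfies ∫₀^∞ e^{t·λ} · (c/B(a,b)) · e^{−b·c·λ} · (1 − e^{−c·λ})^{a−1} dλ = B(b − t/c, a) / B(a,b). -/

import Mathlib

open Real MeasureTheory Finset

/-- The real Beta function `B(r,s) = Γ(r)Γ(s)/Γ(r+s)`. -/
noncomputable def betaFn (r s : ℝ) : ℝ := Real.Gamma r * Real.Gamma s / Real.Gamma (r + s)

/-- Euler's integral for the Beta function over the open unit interval. -/
theorem integral_Ioo_rpow_mul_one_sub_rpow {p q : ℝ} (hp : 0 < p) (hq : 0 < q) :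
    ∫ x in Set.Ioo (0 : ℝ) 1, x ^ (p - 1) * (1 - x) ^ (q - 1) = betaFn p q := by
  change _ = ProbabilityTheory.beta p q
  rw [ProbabilityTheory.beta_eq_betaIntegralReal p q hp hq, Complex.betaIntegral,
    intervalIntegral.integral_of_le zero_le_one, ← integral_Ioc_eq_integral_Ioo,
    ← RCLike.re_to_complex, ← integral_re]
  · refine setIntegral_congr_fun measurableSet_Ioc fun x ⟨hx₀, hx₁⟩ ↦ ?_
    norm_cast
    rw [← Complex.ofReal_cpow, ← Complex.ofReal_cpow, RCLike.re_to_complex,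
      Complex.re_mul_ofReal, Complex.ofReal_re]
    all_goals linarith
  · have h := Complex.betaIntegral_convergent (u := p) (v := q) (by simpa) (by simpa)
    rwa [intervalIntegrable_iff_integrableOn_Ioc_of_le zero_le_one] at h

/-- The map `l ↦ e^{-cl}` sends `(0, ∞)` onto `(0, 1)`. -/
theorem image_exp_neg_mul_Ioi {c : ℝ} (hc : 0 < c) :
    (fun l ↦ Real.exp (-(c * l))) '' Set.Ioi 0 = Set.Ioo 0 1 := by
  ext x
  constructor
  · rintro ⟨l, hl, rfl⟩
    exact ⟨Real.exp_pos _, Real.exp_lt_one_iff.2 (neg_neg_of_pos (mul_pos hc hl))⟩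
  · rintro ⟨hx₀, hx₁⟩
    refine ⟨-Real.log x / c, div_pos (neg_pos.2 (Real.log_neg hx₀ hx₁)) hc, ?_⟩
    simp only [mul_div_cancel₀ _ hc.ne', neg_neg, Real.exp_log hx₀]

/-- Change of variables `x = e^{-cl}` from `(0, 1)` to `(0, ∞)`. -/
theorem integral_Ioo_eq_integral_exp_neg_mul {c : ℝ} (hc : 0 < c) (g : ℝ → ℝ) :
    ∫ x in Set.Ioo (0 : ℝ) 1, g x =
      ∫ l in Set.Ioi (0 : ℝ), c * Real.exp (-(c * l)) * g (Real.exp (-(c * l))) := by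
  have hderiv (l : ℝ) :
      HasDerivAt (fun l ↦ Real.exp (-(c * l))) (-(c * Real.exp (-(c * l)))) l := by
    convert! ((hasDerivAt_id l).const_mul c).neg.exp using 1
    simp only [id_eq, Pi.neg_apply]
    ring
  have hinj : Set.InjOn (fun l ↦ Real.exp (-(c * l))) (Set.Ioi 0) := fun x _ y _ h ↦
    mul_left_cancel₀ hc.ne' (neg_injective (Real.exp_injective h))
  rw [← image_exp_neg_mul_Ioi hc, integral_image_eq_integral_abs_deriv_smul measurableSet_Ioi
    (fun l _ ↦ (hderiv l).hasDerivWithinAt) hinj g]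
  simp only [abs_neg, smul_eq_mul, abs_of_pos (mul_pos hc (Real.exp_pos _))]

/-- The moment generating function of the Beta Exponential distribution:
for `a, b, c > 0` and `t < b·c`,
`∫₀^∞ e^{tλ} (c/B(a,b)) e^{−bcλ} (1−e^{−cλ})^{a−1} dλ = B(b − t/c, a)/B(a,b)`. -/
theorem betaExponential_mgf (a b c t : ℝ) (ha : 0 < a) (hb : 0 < b) (hc : 0 < c)
    (ht : t < b * c) :
    ∫ l in Set.Ioi (0 : ℝ),
        Real.exp (t * l) * (c / betaFn a b) * Real.exp (-(b * c * l)) *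
          (1 - Real.exp (-(c * l))) ^ (a - 1)
      = betaFn (b - t / c) a / betaFn a b := by
  have hp : 0 < b - t / c := sub_pos.2 ((div_lt_iff₀ hc).2 ht)
  rw [← integral_Ioo_rpow_mul_one_sub_rpow hp ha, integral_Ioo_eq_integral_exp_neg_mul hc,
    ← integral_div]
  congr 1 with l
  have hexp : Real.exp (t * l) * Real.exp (-(b * c * l)) =
      Real.exp (-(c * l)) * Real.exp (-(c * l)) ^ (b - t / c - 1) := by
    rw [← Real.exp_mul, ← Real.exp_add, ← Real.exp_add]
    congr 1
    field_simp
    ring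
  linear_combination (c / betaFn a b * (1 - Real.exp (-(c * l))) ^ (a - 1)) * hexp
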